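/- On the hexagonal lattice with L ≥ 8: the energy barrier between any two distinct ground states equals 2L+2, i.e., Γ = Φ(𝐚,𝐛) = 2L+2 for all distinct a, b ∈ Ω. Moreover there is no valley of depth larger than Γ: for every configuration σ ∈ X ∖ S, min_{𝐬 ∈ S} Φ(σ, 𝐬) − H(σ) < Γ. -/

import Mathlib

open scoped Classical BigOperators

namespace IsingHex

/-- Sites of the hexagonal lattice of side length `L` with periodic boundary conditions,
identified with the `2L²` triangular faces of the dual triangular lattice `Λ*`:
`(p, false)` is the up-triangle and `(p, true)` the down-triangle in the rhombic cell `p`. -/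
abbrev Site (L : ℕ) : Type := (ZMod L × ZMod L) × Bool

/-- Spin configurations `X = Ω^Λ` with spin set `Ω = Fin q`. -/
abbrev Conf (L q : ℕ) : Type := Site L → Fin q

/-- Adjacency of the hexagonal lattice: the up-triangle `(p, false)` is adjacent to the
down-triangles `(p, true)`, `(p - (1,0), true)` and `(p - (0,1), true)`. -/
def hexAdj {L : ℕ} (v w : Site L) : Prop :=
  (v.2 = false ∧ w.2 = true ∧
     (w.1 = v.1 ∨ w.1 = (v.1.1 - 1, v.1.2) ∨ w.1 = (v.1.1, v.1.2 - 1))) ∨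
  (v.2 = true ∧ w.2 = false ∧
     (v.1 = w.1 ∨ v.1 = (w.1.1 - 1, w.1.2) ∨ v.1 = (w.1.1, w.1.2 - 1)))

/-- The Hamiltonian `H(σ)`: the number of edges of `Λ` whose endpoints carry different
spins; each edge is counted exactly once through its unique up-triangle endpoint. -/
noncomputable def Ham (L q : ℕ) (σ : Conf L q) : ℕ :=
  Nat.card {e : Site L × Site L // e.1.2 = false ∧ hexAdj e.1 e.2 ∧ σ e.1 ≠ σ e.2}

/-- The monochromatic ground state `𝐚`. -/
def groundConf (L q : ℕ) (a : Fin q) : Conf L q := fun _ => a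

/-- The set `S = {𝟏, …, 𝐪}` of ground states. -/
def groundSet (L q : ℕ) : Set (Conf L q) := {σ | ∃ a : Fin q, σ = groundConf L q a}

/-- Partition function `Z_β`. -/
noncomputable def Zfun (L q : ℕ) (β : ℝ) : ℝ :=
  ∑' σ : Conf L q, Real.exp (-β * (Ham L q σ : ℝ))

/-- Gibbs measure of a set of configurations. -/
noncomputable def gibbsP (L q : ℕ) (β : ℝ) (A : Set (Conf L q)) : ℝ :=
  (∑' σ : Conf L q, A.indicator (fun ζ => Real.exp (-β * (Ham L q ζ : ℝ))) σ) / Zfun L q β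

/-- `σ ∼ ζ`: the two configurations differ at exactly one site. -/
def oneFlip {L q : ℕ} (σ ζ : Conf L q) : Prop :=
  ∃ x : Site L, σ x ≠ ζ x ∧ ∀ y : Site L, y ≠ x → σ y = ζ y

/-- Metropolis jump rates `c_β(σ, ζ)`. -/
noncomputable def rate (L q : ℕ) (β : ℝ) (σ ζ : Conf L q) : ℝ :=
  if oneFlip σ ζ then Real.exp (-β * max ((Ham L q ζ : ℝ) - (Ham L q σ : ℝ)) 0) else 0

/-- There is a `t`-path of single spin flips connecting `σ` and `ζ`. -/
def ConnBelow (L q : ℕ) (t : ℕ) (σ ζ : Conf L q) : Prop :=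
  ∃ (N : ℕ) (ω : ℕ → Conf L q), ω 0 = σ ∧ ω N = ζ ∧
    (∀ n < N, oneFlip (ω n) (ω (n + 1))) ∧ ∀ n ≤ N, Ham L q (ω n) ≤ t

/-- Communication height `Φ(σ, ζ)`. -/
noncomputable def commHeight (L q : ℕ) (σ ζ : Conf L q) : ℕ :=
  sInf {t : ℕ | ConnBelow L q t σ ζ}

/-- The strip of index `ℓ` in direction `d` (`0` = horizontal, `1` = vertical,
`2` = diagonal): `2L` consecutive triangles winding around the torus. -/
def stripSet (L : ℕ) (d : Fin 3) (ℓ : ZMod L) : Set (Site L) :=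
  if d = 0 then {v | v.1.2 = ℓ}
  else if d = 1 then {v | v.1.1 = ℓ}
  else {v | (v.2 = false ∧ v.1.1 + v.1.2 = ℓ) ∨ (v.2 = true ∧ v.1.1 + v.1.2 = ℓ - 1)}

/-- Strip energy `ΔH_s(σ)`: number of adjacent pairs inside the strip with different spins. -/
noncomputable def stripEnergy (L q : ℕ) (σ : Conf L q) (d : Fin 3) (ℓ : ZMod L) : ℕ :=
  Nat.card {e : Site L × Site L //
    e.1.2 = false ∧ e.1 ∈ stripSet L d ℓ ∧ e.2 ∈ stripSet L d ℓ ∧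
      hexAdj e.1 e.2 ∧ σ e.1 ≠ σ e.2}

/-- The strip `(d, ℓ)` is an `a`-bridge of `σ`. -/
def IsBridgeWith (L q : ℕ) (σ : Conf L q) (d : Fin 3) (ℓ : ZMod L) (a : Fin q) : Prop :=
  ∀ v ∈ stripSet L d ℓ, σ v = a

/-- The strip `(d, ℓ)` is a bridge of `σ`. -/
def IsBridge (L q : ℕ) (σ : Conf L q) (d : Fin 3) (ℓ : ZMod L) : Prop :=
  ∃ a : Fin q, IsBridgeWith L q σ d ℓ a

/-- Cyclic enumeration of the strip `(d, ℓ)` by `ZMod (2L)`, consecutive triangles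
being adjacent. -/
def stripCycle (L : ℕ) (d : Fin 3) (ℓ : ZMod L) (k : ZMod (2 * L)) : Site L :=
  let t : ZMod L := ((k.val / 2 : ℕ) : ZMod L)
  if d = 0 then ((t, ℓ), decide (k.val % 2 = 1))
  else if d = 1 then ((ℓ, t), decide (k.val % 2 = 1))
  else if k.val % 2 = 1 then ((t, ℓ - 1 - t), true) else ((t, ℓ - t), false)

/-- A set of triangles is an arc (a set of consecutive triangles) of the strip `(d, ℓ)`. -/
def IsArc (L : ℕ) (d : Fin 3) (ℓ : ZMod L) (S : Set (Site L)) : Prop :=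
  ∃ (s : ZMod (2 * L)) (m : ℕ),
    S = (fun k : ℕ => stripCycle L d ℓ (s + (k : ZMod (2 * L)))) '' Set.Iio m

/-- The strip `(d, ℓ)` is an `{a,b}`-semibridge of `σ`: it carries exactly the two
spins `a ≠ b`, and the sites carrying each spin are consecutive in the strip. -/
def IsSemibridgePair (L q : ℕ) (σ : Conf L q) (d : Fin 3) (ℓ : ZMod L) (a b : Fin q) : Prop :=
  a ≠ b ∧ (∀ v ∈ stripSet L d ℓ, σ v = a ∨ σ v = b) ∧
    (∃ v ∈ stripSet L d ℓ, σ v = a) ∧ (∃ v ∈ stripSet L d ℓ, σ v = b) ∧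
    IsArc L d ℓ {v ∈ stripSet L d ℓ | σ v = a} ∧ IsArc L d ℓ {v ∈ stripSet L d ℓ | σ v = b}

/-- The strip `(d, ℓ)` is a semibridge of `σ`. -/
def IsSemibridge (L q : ℕ) (σ : Conf L q) (d : Fin 3) (ℓ : ZMod L) : Prop :=
  ∃ a b : Fin q, IsSemibridgePair L q σ d ℓ a b

/-- `σ` has an `a`-cross: two `a`-bridges in different directions. -/
def HasCross (L q : ℕ) (σ : Conf L q) (a : Fin q) : Prop :=
  ∃ (d d' : Fin 3) (ℓ ℓ' : ZMod L),
    d ≠ d' ∧ IsBridgeWith L q σ d ℓ a ∧ IsBridgeWith L q σ d' ℓ' a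

/-- `σ` is cross-free. -/
def CrossFree (L q : ℕ) (σ : Conf L q) : Prop := ∀ a : Fin q, ¬ HasCross L q σ a

/-- Connected subsets of the torus `𝕋_L` of strip indices (the collection `𝔖_L`). -/
def CircConn (L : ℕ) (P : Set (ZMod L)) : Prop :=
  ∀ x ∈ P, ∀ y ∈ P, ∃ (N : ℕ) (γ : ℕ → ZMod L), γ 0 = x ∧ γ N = y ∧
    (∀ n ≤ N, γ n ∈ P) ∧ ∀ n < N, γ (n + 1) = γ n + 1 ∨ γ (n + 1) = γ n - 1

/-- Union of the strips with indices in `P`, in direction `d`. -/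
def stripUnion (L : ℕ) (d : Fin 3) (P : Set (ZMod L)) : Set (Site L) :=
  ⋃ ℓ ∈ P, stripSet L d ℓ

/-- The configuration `ξ^{a,b}_U`: spin `b` on `U` and spin `a` elsewhere. -/
noncomputable def xiConf (L q : ℕ) (a b : Fin q) (U : Set (Site L)) : Conf L q :=
  fun v => if v ∈ U then b else a

/-- `σ ∈ R_n^{a,b}`: a regular configuration between `𝐚` and `𝐛` built from `n` strips. -/
def IsRegular (L q : ℕ) (σ : Conf L q) (a b : Fin q) (n : ℕ) : Prop :=
  ∃ (d : Fin 3) (P : Set (ZMod L)), CircConn L P ∧ P.ncard = n ∧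
    σ = xiConf L q a b (stripUnion L d P)

/-- The vertices (in the triangular lattice) of the triangle `v`. -/
def triVerts (L : ℕ) (v : Site L) : Set (ZMod L × ZMod L) :=
  if v.2 = false then {v.1, (v.1.1 + 1, v.1.2), (v.1.1, v.1.2 + 1)}
  else {(v.1.1 + 1, v.1.2), (v.1.1, v.1.2 + 1), (v.1.1 + 1, v.1.2 + 1)}

/-- A connected set of triangles (connected through shared sides). -/
def ConnSet (L : ℕ) (U : Set (Site L)) : Prop :=
  ∀ x ∈ U, ∀ y ∈ U, ∃ (N : ℕ) (γ : ℕ → Site L), γ 0 = x ∧ γ N = y ∧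
    (∀ n ≤ N, γ n ∈ U) ∧ ∀ n < N, hexAdj (γ n) (γ (n + 1))

/-- A one-dimensional canonical set inside the strip `(d, ℓ)`. -/
def OneDimCanonical (L : ℕ) (d : Fin 3) (ℓ : ZMod L) (U : Set (Site L)) : Prop :=
  U ⊆ stripSet L d ℓ ∧ U.Nonempty ∧ U ≠ stripSet L d ℓ ∧
  (ConnSet L U ∨
    (Even U.ncard ∧ ∃ (U₁ : Set (Site L)) (y : Site L),
      U = U₁ ∪ {y} ∧ y ∉ U₁ ∧ U₁.Nonempty ∧ ConnSet L U₁ ∧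
      (∀ x ∈ U₁, ¬ hexAdj x y) ∧ ∃ x ∈ U₁, (triVerts L x ∩ triVerts L y).Nonempty))

/-- `P ≺ P'`: connected index sets with `P ⊆ P'` and `|P'| = |P| + 1`. -/
def StepPair (L : ℕ) (P P' : Set (ZMod L)) : Prop :=
  CircConn L P ∧ CircConn L P' ∧ P ⊆ P' ∧ P'.ncard = P.ncard + 1

/-- A protuberance attached to `s(P)` inside the strip `(d, ℓ)`: a one-dimensional
canonical set such that, when `1 ≤ |P| ≤ L-2`, at least half of its triangles share a
side with `s(P)`. -/
def IsProtuberance (L : ℕ) (d : Fin 3) (P : Set (ZMod L)) (ℓ : ZMod L)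
    (U : Set (Site L)) : Prop :=
  OneDimCanonical L d ℓ U ∧
    (1 ≤ P.ncard → P.ncard ≤ L - 2 →
      U.ncard ≤ 2 * {x ∈ U | ∃ y ∈ stripUnion L d P, hexAdj x y}.ncard)

/-- `‖σ‖_a`: the number of sites with spin `a`. -/
noncomputable def spinCount (L q : ℕ) (σ : Conf L q) (a : Fin q) : ℕ :=
  Nat.card {x : Site L // σ x = a}

/-- `N̂(S)`: configurations connected to a ground state by a `(2L+2)`-path. -/
def NHatGround (L q : ℕ) : Set (Conf L q) :=
  {ζ | ∃ a : Fin q, ConnBelow L q (2 * L + 2) (groundConf L q a) ζ}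

/-- A nice pair of configurations (relative to the partition class `A`). -/
def NicePair (L q : ℕ) (A : Finset (Fin q)) (σ ζ : Conf L q) : Prop :=
  σ ∉ NHatGround L q ∧ ζ ∉ NHatGround L q ∧ oneFlip σ ζ ∧
    (∑ a ∈ A, spinCount L q σ a) = L ^ 2 ∧ (∑ a ∈ A, spinCount L q ζ a) = L ^ 2 - 1

/-- `u` is the vector of mean hitting times `σ ↦ E_σ[τ_A]` of the Metropolis dynamics:
it vanishes on `A` and satisfies the first-step (harmonicity) equations off `A`. -/
def IsMeanHittingTime (L q : ℕ) (β : ℝ) (A : Set (Conf L q)) (u : Conf L q → ℝ) : Prop :=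
  (∀ σ ∈ A, u σ = 0) ∧
    ∀ σ ∉ A, (∑' ζ : Conf L q, rate L q β σ ζ) * u σ =
      1 + ∑' ζ : Conf L q, rate L q β σ ζ * u ζ

/-- Gibbs weight `μ_β(σ)`. -/
noncomputable def gibbsWeight (L q : ℕ) (β : ℝ) (σ : Conf L q) : ℝ :=
  Real.exp (-β * (Ham L q σ : ℝ)) / Zfun L q β

/-- The Dirichlet form `D_β(f)`. -/
noncomputable def dirichletForm (L q : ℕ) (β : ℝ) (f : Conf L q → ℝ) : ℝ :=
  (1 / 2) * ∑' p : Conf L q × Conf L q,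
    gibbsWeight L q β p.1 * rate L q β p.1 p.2 * (f p.2 - f p.1) ^ 2

/-- `h` is the equilibrium potential `h^β_{A,B}(σ) = P_σ[τ_A < τ_B]`: it equals `1` on
`A`, `0` on `B`, and is harmonic for the Metropolis dynamics off `A ∪ B`. -/
def IsEqPotential (L q : ℕ) (β : ℝ) (A B : Set (Conf L q)) (h : Conf L q → ℝ) : Prop :=
  (∀ σ ∈ A, h σ = 1) ∧ (∀ σ ∈ B, h σ = 0) ∧
    ∀ σ, σ ∉ A → σ ∉ B → (∑' ζ : Conf L q, rate L q β σ ζ * (h σ - h ζ)) = 0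


/-! ### Auxiliary material -/

/-- Indicator of disagreement. -/
noncomputable def ein (P Q : Prop) : ℕ := if (P ↔ Q) then 0 else 1

/-- Edges (oriented from the up-triangle) crossing the boundary of `A`. -/
def bdry (L : ℕ) (A : Set (Site L)) : Set (Site L × Site L) :=
  {e | e.1.2 = false ∧ hexAdj e.1 e.2 ∧ ¬ (e.1 ∈ A ↔ e.2 ∈ A)}

/-- Edges (oriented from the up-triangle) with disagreeing spins. -/
def disS (L q : ℕ) (σ : Conf L q) : Set (Site L × Site L) :=
  {e | e.1.2 = false ∧ hexAdj e.1 e.2 ∧ σ e.1 ≠ σ e.2}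

/-- Perimeter. -/
noncomputable def per (L : ℕ) (A : Set (Site L)) : ℕ := (bdry L A).ncard

theorem Ham_eq (L q : ℕ) (σ : Conf L q) : Ham L q σ = (disS L q σ).ncard := rfl

/-- Overlay: spin `a` on `A`, `σ` elsewhere. -/
noncomputable def ov {L q : ℕ} (a : Fin q) (A : Set (Site L)) (σ : Conf L q) : Conf L q :=
  fun v => if v ∈ A then a else σ v

theorem Ham_ov (L q : ℕ) [NeZero L] (a : Fin q) (A : Set (Site L)) (σ : Conf L q) :
    Ham L q (ov a A σ) ≤ Ham L q σ + per L A := by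
  rw [Ham_eq, Ham_eq, per]
  refine le_trans (Set.ncard_le_ncard ?_ (Set.toFinite _)) (Set.ncard_union_le _ _)
  rintro ⟨x, y⟩ ⟨h1, h2, h3⟩
  simp only [ov, disS, bdry, Set.mem_union, Set.mem_ofPred_eq] at *
  by_cases hx : x ∈ A <;> by_cases hy : y ∈ A <;> simp_all

theorem Ham_ov_strict (L q : ℕ) [NeZero L] (a : Fin q) (A : Set (Site L)) (σ : Conf L q)
    (v w : Site L) (hv : v ∈ A) (hw : w ∈ A) (hvw : (v, w) ∈ disS L q σ) :
    Ham L q (ov a A σ) + 1 ≤ Ham L q σ + per L A := by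
  have h0 : Ham L q (ov a A σ) ≤ (disS L q σ \ {(v, w)}).ncard + per L A := by
    rw [Ham_eq, per]
    refine le_trans (Set.ncard_le_ncard ?_ (Set.toFinite _)) (Set.ncard_union_le _ _)
    rintro ⟨x, y⟩ ⟨h1, h2, h3⟩
    by_cases hx : x ∈ A
    · by_cases hy : y ∈ A
      · simp [ov, hx, hy] at h3
      · right
        exact ⟨h1, h2, by simp [hx, hy]⟩
    · by_cases hy : y ∈ A
      · right
        exact ⟨h1, h2, by simp [hx, hy]⟩
      · left
        refine ⟨⟨h1, h2, by simpa [ov, hx, hy] using h3⟩, ?_⟩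
        simp only [Set.mem_singleton_iff, Prod.mk.injEq]
        rintro ⟨rfl, rfl⟩
        exact hx hv
  have h1 := Set.ncard_sdiff_singleton_add_one hvw (Set.toFinite _)
  rw [Ham_eq L q σ]
  omega

theorem per_le_Ham (L q : ℕ) [NeZero L] (a : Fin q) (σ : Conf L q) :
    per L {s | σ s ≠ a} ≤ Ham L q σ := by
  rw [Ham_eq, per]
  refine Set.ncard_le_ncard ?_ (Set.toFinite _)
  rintro ⟨x, y⟩ ⟨h1, h2, h3⟩
  refine ⟨h1, h2, fun h => h3 ?_⟩
  simp only [Set.mem_ofPred_eq] at *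
  rw [h]

theorem per_eq (L : ℕ) [NeZero L] (hL : 2 ≤ L) (A : Set (Site L)) :
    per L A = ∑ i : ZMod L, ∑ j : ZMod L,
      (ein (((i, j), false) ∈ A) (((i, j), true) ∈ A)
       + ein (((i, j), false) ∈ A) (((i - 1, j), true) ∈ A)
       + ein (((i, j), false) ∈ A) (((i, j - 1), true) ∈ A)) := by
  have : Fact (1 < L) := ⟨hL⟩
  have h1 : per L A = ∑ v : Site L, ∑ w : Site L,
      (if v.2 = false ∧ hexAdj v w ∧ ¬ (v ∈ A ↔ w ∈ A) then 1 else 0) := by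
    rw [per, Set.ncard_eq_toFinset_card', ← Fintype.sum_prod_type', Finset.sum_boole]
    simp only [Nat.cast_id]
    congr 1
    ext e
    rw [Set.mem_toFinset, Finset.mem_filter]
    exact ⟨fun h => ⟨Finset.mem_univ _, h⟩, fun h => h.2⟩
  rw [h1, Fintype.sum_prod_type, Fintype.sum_prod_type]
  refine Finset.sum_congr rfl fun i _ => Finset.sum_congr rfl fun j _ => ?_
  rw [Fintype.sum_bool]
  simp only [Bool.true_eq_false, false_and, if_false, Finset.sum_const_zero, zero_add, true_and]
  have h2 : ∀ w : Site L, (if hexAdj ((i, j), false) w ∧ ¬ (((i, j), false) ∈ A ↔ w ∈ A) then 1 else 0)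
      = if w ∈ ({((i, j), true), ((i - 1, j), true), ((i, j - 1), true)} : Finset (Site L)) then
        ein (((i, j), false) ∈ A) (w ∈ A) else 0 := by
    rintro ⟨⟨x, y⟩, b⟩
    have : hexAdj ((i, j), false) ((x, y), b) ↔ ((x, y), b) ∈ ({((i, j), true), ((i - 1, j), true), ((i, j - 1), true)} : Finset (Site L)) := by
      cases b <;> simp [hexAdj]
    by_cases h : hexAdj ((i, j), false) ((x, y), b)
    · rw [if_pos (this.1 h)]
      simp [h, ein]
    · rw [if_neg (mt this.2 h)]
      simp [h]
  simp only [h2]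
  rw [Finset.sum_ite_mem, Finset.univ_inter, Finset.sum_insert, Finset.sum_insert, Finset.sum_singleton]
  · ring
  · simp
  · have h3 : ∀ x : ZMod L, ¬ x = x - 1 := fun x hx => by
      have : (1 : ZMod L) = 0 := by linear_combination hx
      exact one_ne_zero this
    simp [h3]

theorem ein_cast (P Q : Prop) : ((ein P Q : ℕ) : ZMod 2) =
    (if P then 1 else 0) + (if Q then 1 else 0) := by
  unfold ein
  by_cases hP : P <;> by_cases hQ : Q <;> simp [hP, hQ] <;> decide

theorem ncard_sum (L : ℕ) [NeZero L] (A : Set (Site L)) :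
    A.ncard = ∑ i : ZMod L, ∑ j : ZMod L,
      ((if ((i, j), true) ∈ A then 1 else 0) + (if ((i, j), false) ∈ A then 1 else 0)) := by
  rw [Set.ncard_eq_toFinset_card']
  have : A.toFinset.card = ∑ s : Site L, if s ∈ A then 1 else 0 := by
    rw [Finset.sum_boole]; simp only [Nat.cast_id]; congr 1; ext e; simp
  rw [this, Fintype.sum_prod_type, Fintype.sum_prod_type]
  simp only [Fintype.sum_bool]

theorem per_parity (L : ℕ) [NeZero L] (hL : 2 ≤ L) (A : Set (Site L)) :
    ((per L A : ℕ) : ZMod 2) = ((A.ncard : ℕ) : ZMod 2) := by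
  rw [per_eq L hL, ncard_sum]
  push_cast
  simp only [ein_cast, Finset.sum_add_distrib]
  have e1 : ∑ i : ZMod L, ∑ j : ZMod L, (if ((i - 1, j), true) ∈ A then (1 : ZMod 2) else 0)
      = ∑ i : ZMod L, ∑ j : ZMod L, (if ((i, j), true) ∈ A then (1 : ZMod 2) else 0) :=
    Equiv.sum_comp (Equiv.subRight (1 : ZMod L))
      (fun i => ∑ j : ZMod L, (if ((i, j), true) ∈ A then (1 : ZMod 2) else 0))
  have e2 : ∑ i : ZMod L, ∑ j : ZMod L, (if ((i, j - 1), true) ∈ A then (1 : ZMod 2) else 0)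
      = ∑ i : ZMod L, ∑ j : ZMod L, (if ((i, j), true) ∈ A then (1 : ZMod 2) else 0) :=
    Finset.sum_congr rfl fun i _ => Equiv.sum_comp (Equiv.subRight (1 : ZMod L))
      (fun j => (if ((i, j), true) ∈ A then (1 : ZMod 2) else 0))
  rw [e1, e2]
  generalize (∑ i : ZMod L, ∑ j : ZMod L, (if ((i, j), true) ∈ A then (1 : ZMod 2) else 0)) = x
  generalize (∑ i : ZMod L, ∑ j : ZMod L, (if ((i, j), false) ∈ A then (1 : ZMod 2) else 0)) = y
  revert x y
  decide

/-! ### The canonical order -/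

/-- Row-by-row order. -/
def idx0 (L : ℕ) (s : Site L) : ℕ :=
  2 * (L * s.1.2.val + s.1.1.val) + (if s.2 = true then 1 else 0)

theorem val_lt_pair (L : ℕ) (x y x' y' : ℕ) (hx : x < L) (hx' : x' < L)
    (h : L * y + x = L * y' + x') : y = y' ∧ x = x' := by
  have h1 : (L * y + x) / L = y := by
    rw [Nat.mul_add_div (by omega), Nat.div_eq_of_lt hx, add_zero]
  have h2 : (L * y' + x') / L = y' := by
    rw [Nat.mul_add_div (by omega), Nat.div_eq_of_lt hx', add_zero]
  have : y = y' := by rw [← h1, ← h2, h]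
  subst this
  exact ⟨rfl, by omega⟩

theorem idx0_inj (L : ℕ) [NeZero L] : Function.Injective (idx0 L) := by
  rintro ⟨⟨x, y⟩, b⟩ ⟨⟨x', y'⟩, b'⟩ h
  have hb : b = b' := by
    cases b <;> cases b' <;> simp [idx0] at h ⊢ <;> omega
  subst hb
  simp only [idx0] at h
  obtain ⟨h1, h2⟩ := val_lt_pair L x.val y.val x'.val y'.val (ZMod.val_lt _) (ZMod.val_lt _) (by omega)
  rw [ZMod.val_injective L h1, ZMod.val_injective L h2]

theorem idx0_lt (L : ℕ) [NeZero L] (s : Site L) : idx0 L s < 2 * (L * L) := by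
  have h1 := ZMod.val_lt s.1.1
  have h2 := ZMod.val_lt s.1.2
  have h3 : L * s.1.2.val + L ≤ L * L := by nlinarith
  unfold idx0
  split_ifs <;> omega

theorem val_sub_one {L : ℕ} [NeZero L] (hL : 2 ≤ L) (x : ZMod L) :
    (x = 0 ∧ (x - 1).val = L - 1) ∨ (x ≠ 0 ∧ (x - 1).val + 1 = x.val) := by
  have : Fact (1 < L) := ⟨hL⟩
  by_cases h : x = 0
  · left
    refine ⟨h, ?_⟩
    subst h
    obtain ⟨m, rfl⟩ : ∃ m, L = m + 1 := ⟨L - 1, by omega⟩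
    rw [zero_sub, ZMod.val_neg_one]
    rfl
  · right
    refine ⟨h, ?_⟩
    have h1 : x.val ≠ 0 := fun h' => h ((ZMod.val_eq_zero x).1 h')
    rw [ZMod.val_sub (by rw [ZMod.val_one]; omega), ZMod.val_one]
    omega

theorem ein_le_one (P Q : Prop) : ein P Q ≤ 1 := by unfold ein; split_ifs <;> simp

theorem sum_le_one_of_unique {α : Type*} [Fintype α] (f : α → ℕ) (h1 : ∀ x, f x ≤ 1)
    (h : ∀ x y, f x ≠ 0 → f y ≠ 0 → x = y) : ∑ x, f x ≤ 1 := by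
  by_cases hx : ∃ x, f x ≠ 0
  · obtain ⟨x, hx⟩ := hx
    rw [Finset.sum_eq_single x]
    · exact h1 x
    · intro y _ hy
      by_contra h'
      exact hy (h y x h' hx)
    · simp
  · push Not at hx
    simp [hx]

theorem ein_ne (P Q : Prop) : ein P Q ≠ 0 ↔ ¬ (P ↔ Q) := by unfold ein; split_ifs <;> simp_all

theorem per_idx0 (L : ℕ) [NeZero L] (hL : 2 ≤ L) (n : ℕ) :
    per L {s | idx0 L s < n} ≤ 2 * L + 2 := by
  have : Fact (1 < L) := ⟨hL⟩
  rw [per_eq L hL]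
  simp only [Finset.sum_add_distrib]
  -- vertical part
  have hV : ∀ i : ZMod L, ∑ j : ZMod L, ein (((i, j), false) ∈ {s | idx0 L s < n})
      (((i, j - 1), true) ∈ {s | idx0 L s < n}) ≤ 2 := by
    intro i
    have hi := ZMod.val_lt i
    rw [← Finset.add_sum_erase _ _ (Finset.mem_univ (0 : ZMod L))]
    have a1 := ein_le_one (((i, (0 : ZMod L)), false) ∈ {s | idx0 L s < n})
      (((i, 0 - 1), true) ∈ {s | idx0 L s < n})
    refine le_trans (Nat.add_le_add a1 (?_ : _ ≤ 1)) (by norm_num)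
    rw [← Finset.sum_coe_sort (Finset.univ.erase (0 : ZMod L))]
    refine sum_le_one_of_unique _ (fun _ => ein_le_one _ _) ?_
    rintro ⟨x, hx⟩ ⟨y, hy⟩ h1 h2
    rw [ein_ne] at h1 h2
    simp only [Finset.mem_erase, Finset.mem_univ, and_true] at hx hy
    simp only [Set.mem_ofPred_eq, idx0] at h1 h2
    have vx := (val_sub_one hL x).resolve_left (fun h => hx h.1)
    have vy := (val_sub_one hL y).resolve_left (fun h => hy h.1)
    rw [← vx.2] at h1
    rw [← vy.2] at h2
    simp only [mul_add, Bool.false_eq_true, if_false, if_true, mul_one] at h1 h2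
    have : x.val = y.val := by
      rw [← vx.2, ← vy.2]
      generalize (x-1).val = X at *
      generalize (y-1).val = Y at *
      rcases lt_trichotomy X Y with h | h | h
      · have : L * X + L ≤ L * Y := by nlinarith
        exfalso; omega
      · omega
      · have : L * Y + L ≤ L * X := by nlinarith
        exfalso; omega
    exact Subtype.ext (ZMod.val_injective L this)
  have hV' : ∑ i : ZMod L, ∑ j : ZMod L, ein (((i, j), false) ∈ {s | idx0 L s < n})
      (((i, j - 1), true) ∈ {s | idx0 L s < n}) ≤ 2 * L := by
    refine le_trans (Finset.sum_le_sum fun i _ => hV i) ?_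
    simp [ZMod.card, mul_comm]
  -- same-cell part and row part
  have hE : ∑ i : ZMod L, ∑ j : ZMod L, (ein (((i, j), false) ∈ {s | idx0 L s < n})
      (((i, j), true) ∈ {s | idx0 L s < n}) + if i = 0 then 0 else ein (((i, j), false) ∈ {s | idx0 L s < n})
      (((i - 1, j), true) ∈ {s | idx0 L s < n})) ≤ 1 := by
    have key : ∀ p : ZMod L × ZMod L, (ein ((p, false) ∈ {s | idx0 L s < n})
      ((p, true) ∈ {s | idx0 L s < n}) ≠ 0 → n = 2 * (L * p.2.val + p.1.val) + 1) ∧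
      ((if p.1 = 0 then 0 else ein ((p, false) ∈ {s | idx0 L s < n})
      (((p.1 - 1, p.2), true) ∈ {s | idx0 L s < n})) ≠ 0 → n = 2 * (L * p.2.val + p.1.val)) := by
      rintro ⟨i, j⟩
      constructor
      · rw [ein_ne]
        simp only [Set.mem_ofPred_eq, idx0]
        simp
        omega
      · by_cases hi : i = 0
        · simp [hi]
        · have vx := (val_sub_one hL i).resolve_left (fun h => hi h.1)
          simp only [hi, if_false]
          rw [ein_ne]
          simp only [Set.mem_ofPred_eq, idx0]
          rw [← vx.2]
          simp
          omega
    rw [← Fintype.sum_prod_type']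
    refine sum_le_one_of_unique _ ?_ ?_
    · rintro ⟨i, j⟩
      by_contra h
      obtain ⟨k1, k2⟩ := key (i, j)
      dsimp only at h k1 k2
      have b1 := ein_le_one (((i, j), false) ∈ {s | idx0 L s < n}) (((i, j), true) ∈ {s | idx0 L s < n})
      have b2 : (if i = 0 then 0 else ein (((i, j), false) ∈ {s | idx0 L s < n})
        (((i - 1, j), true) ∈ {s | idx0 L s < n})) ≤ 1 := by
        split_ifs
        · simp
        · exact ein_le_one _ _
      have := k1 (fun h' => by omega)
      have := k2 (fun h' => by omega)
      omega
    · intro p p' h h'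
      obtain ⟨k1, k2⟩ := key p
      obtain ⟨k1', k2'⟩ := key p'
      have c1 : n = 2 * (L * p.2.val + p.1.val) + 1 ∨ n = 2 * (L * p.2.val + p.1.val) := by
        by_contra hc
        rw [not_or] at hc
        exact h (by rw [not_not.1 (mt k1 hc.1), not_not.1 (mt k2 hc.2)])
      have c2 : n = 2 * (L * p'.2.val + p'.1.val) + 1 ∨ n = 2 * (L * p'.2.val + p'.1.val) := by
        by_contra hc
        rw [not_or] at hc
        exact h' (by rw [not_not.1 (mt k1' hc.1), not_not.1 (mt k2' hc.2)])
      obtain ⟨h1, h2⟩ := val_lt_pair L p.1.val p.2.val p'.1.val p'.2.val (ZMod.val_lt _)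
        (ZMod.val_lt _) (by omega)
      exact Prod.ext (ZMod.val_injective L h2) (ZMod.val_injective L h1)
  have hW : ∑ j : ZMod L, ein ((((0 : ZMod L), j), false) ∈ {s | idx0 L s < n})
      (((0 - 1, j), true) ∈ {s | idx0 L s < n}) ≤ 1 := by
    refine sum_le_one_of_unique _ (fun _ => ein_le_one _ _) ?_
    intro x y h1 h2
    rw [ein_ne] at h1 h2
    simp only [Set.mem_ofPred_eq, idx0] at h1 h2
    have v0 : ((0 : ZMod L) - 1).val = L - 1 := by
      rcases val_sub_one hL (0 : ZMod L) with h | h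
      · exact h.2
      · exact absurd rfl h.1
    rw [v0] at h1 h2
    simp at h1 h2
    apply ZMod.val_injective L
    generalize x.val = X at *
    generalize y.val = Y at *
    rcases lt_trichotomy X Y with h | h | h
    · have : L * X + L ≤ L * Y := by nlinarith
      exfalso; omega
    · omega
    · have : L * Y + L ≤ L * X := by nlinarith
      exfalso; omega
  have hS : ∑ i : ZMod L, ∑ j : ZMod L, ein (((i, j), false) ∈ {s | idx0 L s < n})
      (((i - 1, j), true) ∈ {s | idx0 L s < n}) =
      ∑ j : ZMod L, ein ((((0 : ZMod L), j), false) ∈ {s | idx0 L s < n})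
      (((0 - 1, j), true) ∈ {s | idx0 L s < n}) +
      ∑ i : ZMod L, ∑ j : ZMod L, (if i = 0 then 0 else ein (((i, j), false) ∈ {s | idx0 L s < n})
      (((i - 1, j), true) ∈ {s | idx0 L s < n})) := by
    rw [← Finset.add_sum_erase _ _ (Finset.mem_univ (0 : ZMod L))]
    congr 1
    conv_rhs => rw [← Finset.add_sum_erase _ _ (Finset.mem_univ (0 : ZMod L))]
    simp only [if_true, Finset.sum_const_zero, zero_add]
    refine Finset.sum_congr rfl fun i hi => ?_
    simp only [(Finset.mem_erase.1 hi).1, if_false]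
  simp only [Finset.sum_add_distrib] at hE
  rw [hS]
  omega

/-! ### Transport of the canonical order -/

theorem exists_map (L : ℕ) [NeZero L] (v w : Site L) (hv : v.2 = false) (h : hexAdj v w) :
    ∃ φ : Site L → Site L, Function.Injective φ ∧ (∀ x, (φ x).2 = x.2) ∧
      (∀ x y, x.2 = false → hexAdj x y → hexAdj (φ x) (φ y)) ∧
      φ v = ((0, 0), false) ∧ φ w = ((0, 0), true) := by
  obtain ⟨⟨p, r⟩, b⟩ := v
  obtain ⟨⟨p', r'⟩, b'⟩ := w
  simp only at hv
  subst hv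
  simp only [hexAdj, Bool.false_eq_true, false_and, or_false, true_and, Prod.mk.injEq] at h
  obtain ⟨rfl, h⟩ := h
  rcases h with ⟨rfl, rfl⟩ | ⟨rfl, rfl⟩ | ⟨rfl, rfl⟩
  · refine ⟨fun s => ((s.1.1 - p', s.1.2 - r'), s.2), ?_, fun _ => rfl, ?_, by simp, by simp⟩
    · rintro ⟨⟨x, y⟩, b⟩ ⟨⟨x', y'⟩, b'⟩ h
      simpa using h
    · rintro ⟨⟨x, y⟩, b⟩ ⟨⟨x', y'⟩, b'⟩ hb h
      simp only at hb
      subst hb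
      simp only [hexAdj, Bool.false_eq_true, false_and, or_false, true_and, Prod.mk.injEq] at h ⊢
      obtain ⟨rfl, h⟩ := h
      refine ⟨rfl, ?_⟩
      rcases h with ⟨rfl, rfl⟩ | ⟨rfl, rfl⟩ | ⟨rfl, rfl⟩
      · left; constructor <;> ring
      · right; left; constructor <;> ring
      · right; right; constructor <;> ring
  · refine ⟨fun s => ((-(s.1.1 - p) - (s.1.2 - r') - (if s.2 then 1 else 0), s.1.2 - r'), s.2), ?_, fun _ => rfl, ?_, by simp, by simp⟩
    · rintro ⟨⟨x, y⟩, b⟩ ⟨⟨x', y'⟩, b'⟩ h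
      simp only [Prod.mk.injEq] at h ⊢
      obtain ⟨⟨h1, h2⟩, rfl⟩ := h
      exact ⟨⟨by linear_combination -h1 - h2, by linear_combination h2⟩, rfl⟩
    · rintro ⟨⟨x, y⟩, b⟩ ⟨⟨x', y'⟩, b'⟩ hb h
      simp only at hb
      subst hb
      simp only [hexAdj, Bool.false_eq_true, false_and, or_false, true_and, Prod.mk.injEq] at h ⊢
      obtain ⟨rfl, h⟩ := h
      refine ⟨rfl, ?_⟩
      simp only [if_true, if_false]
      rcases h with ⟨rfl, rfl⟩ | ⟨rfl, rfl⟩ | ⟨rfl, rfl⟩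
      · right; left; constructor <;> ring
      · left; constructor <;> ring
      · right; right; constructor <;> ring
  · refine ⟨fun s => ((s.1.1 - p', -(s.1.1 - p') - (s.1.2 - r) - (if s.2 then 1 else 0)), s.2), ?_, fun _ => rfl, ?_, by simp, by simp⟩
    · rintro ⟨⟨x, y⟩, b⟩ ⟨⟨x', y'⟩, b'⟩ h
      simp only [Prod.mk.injEq] at h ⊢
      obtain ⟨⟨h2, h1⟩, rfl⟩ := h
      exact ⟨⟨by linear_combination h2, by linear_combination -h1 - h2⟩, rfl⟩
    · rintro ⟨⟨x, y⟩, b⟩ ⟨⟨x', y'⟩, b'⟩ hb h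
      simp only at hb
      subst hb
      simp only [hexAdj, Bool.false_eq_true, false_and, or_false, true_and, Prod.mk.injEq] at h ⊢
      obtain ⟨rfl, h⟩ := h
      refine ⟨rfl, ?_⟩
      simp only [if_true, if_false]
      rcases h with ⟨rfl, rfl⟩ | ⟨rfl, rfl⟩ | ⟨rfl, rfl⟩
      · right; right; constructor <;> ring
      · right; left; constructor <;> ring
      · left; constructor <;> ring

theorem per_map_le (L : ℕ) [NeZero L] (φ : Site L → Site L) (h1 : Function.Injective φ)
    (h2 : ∀ x, (φ x).2 = x.2) (h3 : ∀ x y, x.2 = false → hexAdj x y → hexAdj (φ x) (φ y))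
    (A : Set (Site L)) : per L {s | φ s ∈ A} ≤ per L A := by
  refine Set.ncard_le_ncard_of_injOn (fun e => (φ e.1, φ e.2)) ?_ ?_ (Set.toFinite _)
  · rintro ⟨x, y⟩ ⟨a1, a2, a3⟩
    exact ⟨(h2 x).trans a1, h3 x y a1 a2, a3⟩
  · rintro ⟨x, y⟩ _ ⟨x', y'⟩ _ h
    simp only [Prod.mk.injEq] at h ⊢
    exact ⟨h1 h.1, h1 h.2⟩

/-! ### Paths -/

theorem conn_refl (L q t : ℕ) (σ : Conf L q) (h : Ham L q σ ≤ t) : ConnBelow L q t σ σ :=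
  ⟨0, fun _ => σ, rfl, rfl, by simp, fun _ _ => h⟩

theorem conn_snoc (L q t : ℕ) (σ ζ η : Conf L q) (h : ConnBelow L q t σ ζ)
    (h1 : oneFlip ζ η) (h2 : Ham L q η ≤ t) : ConnBelow L q t σ η := by
  obtain ⟨N, ω, a1, a2, a3, a4⟩ := h
  refine ⟨N + 1, fun n => if n ≤ N then ω n else η, by simp [a1], by simp, ?_, ?_⟩
  · intro n hn
    rcases Nat.lt_or_ge n N with h | h
    · have h' : n + 1 ≤ N := h
      simp only [h.le, h', if_true]
      exact a3 n h
    · have : n = N := by omega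
      subst this
      simpa [a2] using h1
  · intro n hn
    by_cases h : n ≤ N
    · simpa [h] using a4 n h
    · simpa [h] using h2

theorem conn_ov (L q t : ℕ) (a : Fin q) (σ : Conf L q) (f : Site L → ℕ)
    (hf : Function.Injective f) (h : ∀ n, Ham L q (ov a {s | f s < n} σ) ≤ t) (n : ℕ) :
    ConnBelow L q t σ (ov a {s | f s < n} σ) := by
  induction n with
  | zero =>
    have : ov a {s | f s < 0} σ = σ := by funext s; simp [ov]
    have h0 := h 0
    rw [this] at h0 ⊢
    exact conn_refl _ _ _ _ h0
  | succ n ih =>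
    by_cases he : ov a {s | f s < n} σ = ov a {s | f s < n + 1} σ
    · rw [← he]; exact ih
    · refine conn_snoc _ _ _ _ _ _ ih ?_ (h _)
      obtain ⟨x, hx⟩ := Function.ne_iff.1 he
      have key : ∀ y, ov a {s | f s < n} σ y ≠ ov a {s | f s < n + 1} σ y → f y = n := by
        intro y hy
        by_contra h'
        apply hy
        have : f y < n ↔ f y < n + 1 := by omega
        simp [ov, this]
      refine ⟨x, hx, fun y hy => ?_⟩
      by_contra h'
      exact hy (hf ((key y h').trans (key x hx).symm))

theorem conn_ground (L q t : ℕ) (a : Fin q) (σ : Conf L q) (f : Site L → ℕ)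
    (hf : Function.Injective f) (M : ℕ) (hM : ∀ s, f s < M)
    (h : ∀ n, Ham L q (ov a {s | f s < n} σ) ≤ t) :
    ConnBelow L q t σ (groundConf L q a) := by
  have := conn_ov L q t a σ f hf h M
  have e : ov a {s | f s < M} σ = groundConf L q a := by
    funext s; simp [ov, groundConf, hM s]
  rwa [e] at this

theorem Ham_ground (L q : ℕ) (a : Fin q) : Ham L q (groundConf L q a) = 0 := by
  rw [Ham_eq]
  have : disS L q (groundConf L q a) = ∅ := by ext; simp [disS, groundConf]
  rw [this, Set.ncard_empty]

theorem upper (L q : ℕ) [NeZero L] (hL : 2 ≤ L) (a b : Fin q) :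
    ConnBelow L q (2 * L + 2) (groundConf L q a) (groundConf L q b) := by
  refine conn_ground L q _ b _ (idx0 L) (idx0_inj L) _ (idx0_lt L) fun n => ?_
  have h1 := Ham_ov L q b {s | idx0 L s < n} (groundConf L q a)
  have h2 := per_idx0 L hL n
  rw [Ham_ground] at h1
  omega

/-- constancy from zero steps around the cycle -/
theorem const_of_step {α : Type*} (L : ℕ) [NeZero L] (g : ZMod L → α)
    (h : ∀ t, g t = g (t - 1)) (t : ZMod L) : g t = g 0 := by
  have : ∀ n : ℕ, g (n : ZMod L) = g 0 := by
    intro n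
    induction n with
    | zero => simp
    | succ n ih => rw [h]; simpa using ih
  simpa using this t.val

theorem exists_dis (L q : ℕ) [NeZero L] (hq : 2 ≤ q) (σ : Conf L q) (hσ : σ ∉ groundSet L q) :
    ∃ v w, (v, w) ∈ disS L q σ := by
  by_contra hno
  push Not at hno
  have h : ∀ v w : Site L, v.2 = false → hexAdj v w → σ v = σ w := by
    intro v w hv hvw
    by_contra h'
    exact hno v w ⟨hv, hvw, h'⟩
  have e1 : ∀ i j : ZMod L, σ ((i, j), false) = σ ((i, j), true) := fun i j =>
    h _ _ rfl (by simp [hexAdj])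
  have e2 : ∀ i j : ZMod L, σ ((i, j), false) = σ ((i - 1, j), true) := fun i j =>
    h _ _ rfl (by simp [hexAdj])
  have e3 : ∀ i j : ZMod L, σ ((i, j), false) = σ ((i, j - 1), true) := fun i j =>
    h _ _ rfl (by simp [hexAdj])
  have c1 : ∀ i j : ZMod L, σ ((i, j), false) = σ ((0, j), false) := fun i j =>
    const_of_step L (fun i => σ ((i, j), false)) (fun t => (e2 t j).trans (e1 _ _).symm) i
  have c2 : ∀ j : ZMod L, σ ((0, j), false) = σ ((0, 0), false) := fun j =>
    const_of_step L (fun j => σ ((0, j), false)) (fun t => (e3 0 t).trans (e1 _ _).symm) j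
  apply hσ
  refine ⟨σ ((0, 0), false), ?_⟩
  funext ⟨⟨i, j⟩, b⟩
  cases b
  · exact (c1 i j).trans (c2 j)
  · exact (e1 i j).symm.trans ((c1 i j).trans (c2 j))

theorem valley (L q : ℕ) [NeZero L] (hL : 2 ≤ L) (hq : 2 ≤ q) (σ : Conf L q)
    (hσ : σ ∉ groundSet L q) (a : Fin q) :
    ConnBelow L q (Ham L q σ + (2 * L + 1)) σ (groundConf L q a) := by
  obtain ⟨v, w, hvw⟩ := exists_dis L q hq σ hσ
  obtain ⟨φ, f1, f2, f3, f4, f5⟩ := exists_map L v w hvw.1 hvw.2.1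
  refine conn_ground L q _ a σ (fun s => idx0 L (φ s)) ((idx0_inj L).comp f1) _
    (fun s => idx0_lt L (φ s)) fun n => ?_
  have hp : per L {s | idx0 L (φ s) < n} ≤ 2 * L + 2 :=
    (per_map_le L φ f1 f2 f3 {s | idx0 L s < n}).trans (per_idx0 L hL n)
  have iv : idx0 L (φ v) = 0 := by rw [f4]; simp [idx0]
  have iw : idx0 L (φ w) = 1 := by rw [f5]; simp [idx0]
  rcases Nat.lt_or_ge n 2 with hn | hn
  · have h1 := Ham_ov L q a {s | idx0 L (φ s) < n} σ
    have hn' : n = 0 ∨ n = 1 := by omega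
    rcases hn' with rfl | rfl
    · have : ov a {s | idx0 L (φ s) < 0} σ = σ := by funext s; simp [ov]
      rw [this]; omega
    · have hA : {s | idx0 L (φ s) < 1} = {v} := by
        ext s
        simp only [Set.mem_ofPred_eq, Set.mem_singleton_iff]
        constructor
        · intro h
          exact f1 (idx0_inj L (by omega))
        · rintro rfl
          omega
      have hpar := per_parity L hL {s | idx0 L (φ s) < 1}
      have hc : ({s | idx0 L (φ s) < 1} : Set (Site L)).ncard = 1 := by rw [hA, Set.ncard_singleton]
      rw [hc, ZMod.natCast_eq_natCast_iff'] at hpar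
      omega
  · have h1 := Ham_ov_strict L q a {s | idx0 L (φ s) < n} σ v w
      (by simp only [Set.mem_ofPred_eq]; omega) (by simp only [Set.mem_ofPred_eq]; omega) hvw
    omega

/-! ### Lower bound: strips -/

/-- Energy of a cyclic strip. -/
noncomputable def sen (L : ℕ) [NeZero L] (u d : ZMod L → Prop) : ℕ :=
  ∑ t : ZMod L, (ein (u t) (d t) + ein (u t) (d (t - 1)))

theorem sen_const (L : ℕ) [NeZero L] (u d : ZMod L → Prop) (h : sen L u d < 2) :
    ∃ c : Prop, ∀ t, (u t ↔ c) ∧ (d t ↔ c) := by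
  have hpar : ((sen L u d : ℕ) : ZMod 2) = 0 := by
    unfold sen
    push_cast
    simp only [ein_cast, Finset.sum_add_distrib]
    have : ∑ t : ZMod L, (if d (t - 1) then (1 : ZMod 2) else 0) = ∑ t : ZMod L, (if d t then (1 : ZMod 2) else 0) :=
      Equiv.sum_comp (Equiv.subRight (1 : ZMod L)) (fun t => (if d t then (1 : ZMod 2) else 0))
    rw [this]
    generalize (∑ t : ZMod L, (if d t then (1 : ZMod 2) else 0)) = x
    generalize (∑ t : ZMod L, (if u t then (1 : ZMod 2) else 0)) = y
    revert x y
    decide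
  have h0 : sen L u d = 0 := by
    have := (ZMod.natCast_eq_zero_iff _ _).1 hpar
    omega
  unfold sen at h0
  rw [Finset.sum_eq_zero_iff] at h0
  have h1 : ∀ t, (u t ↔ d t) ∧ (u t ↔ d (t - 1)) := by
    intro t
    have := h0 t (Finset.mem_univ t)
    constructor
    · by_contra h'
      exact (ein_ne _ _).2 h' (by omega)
    · by_contra h'
      exact (ein_ne _ _).2 h' (by omega)
  have h2 := const_of_step L u (fun t => propext ((h1 t).2.trans (h1 (t - 1)).1.symm))
  exact ⟨u 0, fun t => ⟨by rw [h2 t], by rw [← (h1 t).1, h2 t]⟩⟩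

/-- Strip index in each direction. -/
def lab (L : ℕ) (d : Fin 3) (s : Site L) : ZMod L :=
  if d = 0 then s.1.2 else if d = 1 then s.1.1
  else s.1.1 + s.1.2 + (if s.2 = true then 1 else 0)

theorem lab_bij (L : ℕ) (d d' : Fin 3) (h : d ≠ d') :
    Function.Bijective (fun s : Site L => ((lab L d s, lab L d' s), s.2)) := by
  constructor
  · rintro ⟨⟨x, y⟩, b⟩ ⟨⟨x', y'⟩, b'⟩ he
    simp only [Prod.mk.injEq] at he ⊢
    obtain ⟨⟨h1, h2⟩, rfl⟩ := he
    fin_cases d <;> fin_cases d' <;> simp [lab] at h h1 h2 ⊢ <;> simp_all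
  · rintro ⟨⟨x, y⟩, b⟩
    have hh : ∀ c : ZMod L, ∃ i j : ZMod L, lab L d ((i, j), b) = x ∧ lab L d' ((i, j), b) = y := by
      intro _
      fin_cases d <;> fin_cases d' <;> simp [lab] at h ⊢
      · exact ⟨y - x - (if b = true then 1 else 0), by ring⟩
      · exact ⟨y - x - (if b = true then 1 else 0), by ring⟩
      · exact ⟨x - y - (if b = true then 1 else 0), by ring⟩
      · exact ⟨x - y - (if b = true then 1 else 0), by ring⟩
    obtain ⟨i, j, h1, h2⟩ := hh 0
    exact ⟨((i, j), b), by simp [h1, h2]⟩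

/-- Constant strip. -/
def Bri (L : ℕ) (A : Set (Site L)) (d : Fin 3) (l : ZMod L) (c : Prop) : Prop :=
  ∀ s : Site L, lab L d s = l → (s ∈ A ↔ c)

/-- Set of non-bridges. -/
def nonBri (L : ℕ) (A : Set (Site L)) (d : Fin 3) : Set (ZMod L) :=
  {l | ¬ ∃ c, Bri L A d l c}

theorem nonBri_le (L : ℕ) [NeZero L] (A : Set (Site L)) (d : Fin 3) (E : ZMod L → ℕ)
    (h : ∀ l, E l < 2 → ∃ c, Bri L A d l c) : 2 * (nonBri L A d).ncard ≤ ∑ l, E l := by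
  have h1 : 2 * (nonBri L A d).ncard = ∑ l : ZMod L, if l ∈ nonBri L A d then 2 else 0 := by
    rw [← Finset.sum_filter, Finset.sum_const, smul_eq_mul, mul_comm, Set.ncard_eq_toFinset_card']
    congr 2
    ext; simp
  rw [h1]
  refine Finset.sum_le_sum fun l _ => ?_
  split_ifs with hl
  · by_contra h'
    exact hl (h l (by omega))
  · simp

theorem nonBri_sum (L : ℕ) [NeZero L] (hL : 2 ≤ L) (A : Set (Site L)) :
    (nonBri L A 0).ncard + (nonBri L A 1).ncard + (nonBri L A 2).ncard ≤ per L A := by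
  have r0 := nonBri_le L A 0 (fun l => sen L (fun t => ((t, l), false) ∈ A) (fun t => ((t, l), true) ∈ A))
    (by
      intro l hl
      obtain ⟨c, hc⟩ := sen_const L _ _ hl
      refine ⟨c, ?_⟩
      rintro ⟨⟨x, y⟩, b⟩ hs
      simp [lab] at hs
      subst hs
      cases b
      · exact (hc x).1
      · exact (hc x).2)
  have r1 := nonBri_le L A 1 (fun l => sen L (fun t => ((l, t), false) ∈ A) (fun t => ((l, t), true) ∈ A))
    (by
      intro l hl
      obtain ⟨c, hc⟩ := sen_const L _ _ hl
      refine ⟨c, ?_⟩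
      rintro ⟨⟨x, y⟩, b⟩ hs
      simp [lab] at hs
      subst hs
      cases b
      · exact (hc y).1
      · exact (hc y).2)
  have r2 := nonBri_le L A 2 (fun l => sen L (fun t => ((t, l - t), false) ∈ A) (fun t => ((t, l - 1 - t), true) ∈ A))
    (by
      intro l hl
      obtain ⟨c, hc⟩ := sen_const L _ _ hl
      refine ⟨c, ?_⟩
      rintro ⟨⟨x, y⟩, b⟩ hs
      cases b
      · have : y = l - x := by simp [lab] at hs; rw [← hs]; ring
        subst this
        exact (hc x).1
      · have : y = l - 1 - x := by simp [lab] at hs; rw [← hs]; ring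
        subst this
        exact (hc x).2)
  rw [per_eq L hL]
  simp only [sen, Finset.sum_add_distrib] at r0 r1 r2 ⊢
  rw [Finset.sum_comm (f := fun l t : ZMod L => ein (((t, l), false) ∈ A) (((t, l), true) ∈ A)),
    Finset.sum_comm (f := fun l t : ZMod L => ein (((t, l), false) ∈ A) (((t - 1, l), true) ∈ A))] at r0
  rw [Finset.sum_comm (f := fun l t : ZMod L => ein (((t, l - t), false) ∈ A) (((t, l - 1 - t), true) ∈ A)),
    Finset.sum_comm (f := fun l t : ZMod L => ein (((t, l - t), false) ∈ A) (((t - 1, l - 1 - (t - 1)), true) ∈ A))] at r2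
  have e1 : ∀ t : ZMod L, ∑ l : ZMod L, ein (((t, l - t), false) ∈ A) (((t, l - 1 - t), true) ∈ A)
      = ∑ j : ZMod L, ein (((t, j), false) ∈ A) (((t, j - 1), true) ∈ A) := by
    intro t
    conv_rhs => rw [← Equiv.sum_comp (Equiv.subRight t)]
    refine Finset.sum_congr rfl fun l _ => ?_
    simp only [Equiv.subRight_apply]
    rw [show l - 1 - t = l - t - 1 by ring]
  have e2 : ∀ t : ZMod L, ∑ l : ZMod L, ein (((t, l - t), false) ∈ A) (((t - 1, l - 1 - (t - 1)), true) ∈ A)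
      = ∑ j : ZMod L, ein (((t, j), false) ∈ A) (((t - 1, j), true) ∈ A) := by
    intro t
    conv_rhs => rw [← Equiv.sum_comp (Equiv.subRight t)]
    refine Finset.sum_congr rfl fun l _ => ?_
    simp only [Equiv.subRight_apply]
    rw [show l - 1 - (t - 1) = l - t by ring]
  simp only [e1, e2] at r2
  omega

theorem card_le_prod (L : ℕ) [NeZero L] (A M : Set (Site L)) (d d' : Fin 3) (h : d ≠ d')
    (hM : ∀ s ∈ M, ∀ d, lab L d s ∈ nonBri L A d) :
    M.ncard ≤ 2 * ((nonBri L A d).ncard * (nonBri L A d').ncard) := by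
  have h1 : M.ncard ≤ ((nonBri L A d ×ˢ nonBri L A d') ×ˢ (Set.univ : Set Bool)).ncard := by
    refine Set.ncard_le_ncard_of_injOn (fun s : Site L => ((lab L d s, lab L d' s), s.2)) ?_
      (lab_bij L d d' h).1.injOn (Set.toFinite _)
    intro s hs
    exact ⟨⟨hM s hs d, hM s hs d'⟩, trivial⟩
  rw [Set.ncard_prod, Set.ncard_prod, Set.ncard_univ] at h1
  simp at h1
  omega

theorem arith3 (m x y z L : ℕ) (h : x + y + z ≤ 2 * L) (h1 : m ≤ 2 * (x * y))
    (h2 : m ≤ 2 * (x * z)) (h3 : m ≤ 2 * (y * z)) : 9 * m ≤ 8 * L ^ 2 := by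
  have key : ∀ x y : ℕ, 3 * (x + y) ≤ 4 * L → m ≤ 2 * (x * y) → 9 * m ≤ 8 * L ^ 2 := by
    intro x y hs hm
    zify at *
    nlinarith [sq_nonneg ((x : ℤ) - y), mul_self_le_mul_self (by positivity) hs]
  rcases (by omega : 3 * (x + y) ≤ 4 * L ∨ 3 * (x + z) ≤ 4 * L ∨ 3 * (y + z) ≤ 4 * L) with h' | h' | h'
  · exact key x y h' h1
  · exact key x z h' h2
  · exact key y z h' h3

theorem cross_case (L : ℕ) [NeZero L] (hL : 2 ≤ L) (A : Set (Site L)) (hper : per L A ≤ 2 * L)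
    (d d' : Fin 3) (hd : d ≠ d') (l l' : ZMod L) (c c' : Prop) (hb : Bri L A d l c)
    (hb' : Bri L A d' l' c') : 9 * A.ncard ≤ 8 * L ^ 2 ∨ 9 * Aᶜ.ncard ≤ 8 * L ^ 2 := by
  have meet : ∀ (d d' : Fin 3), d ≠ d' → ∀ (l l' : ZMod L) (c c' : Prop), Bri L A d l c →
      Bri L A d' l' c' → (c ↔ c') := by
    intro d d' hd l l' c c' hb hb'
    obtain ⟨s, hs⟩ := (lab_bij L d d' hd).2 ((l, l'), false)
    simp only [Prod.mk.injEq] at hs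
    exact (hb s hs.1.1).symm.trans (hb' s hs.1.2)
  have hcc := meet d d' hd l l' c c' hb hb'
  have all : ∀ (e : Fin 3) (k : ZMod L) (x : Prop), Bri L A e k x → (x ↔ c) := by
    intro e k x hx
    by_cases he : e = d
    · rw [hcc]
      exact meet e d' (by rw [he]; exact hd) k l' x c' hx hb'
    · exact meet e d he k l x c hx hb
  have hM : ∀ s : Site L, ¬ (s ∈ A ↔ c) → ∀ e, lab L e s ∈ nonBri L A e := by
    rintro s hs e ⟨x, hx⟩
    exact hs ((hx s rfl).trans (all e _ x hx))
  have hsum := nonBri_sum L hL A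
  have fin : ∀ M : Set (Site L), (∀ s ∈ M, ¬ (s ∈ A ↔ c)) → 9 * M.ncard ≤ 8 * L ^ 2 := by
    intro M hM'
    have g : ∀ s ∈ M, ∀ e, lab L e s ∈ nonBri L A e := fun s hs => hM s (hM' s hs)
    exact arith3 _ _ _ _ L (hsum.trans hper) (card_le_prod L A M 0 1 (by decide) g)
      (card_le_prod L A M 0 2 (by decide) g) (card_le_prod L A M 1 2 (by decide) g)
  by_cases hc : c
  · right
    exact fin _ (fun s hs h => hs (h.2 hc))
  · left
    exact fin _ (fun s hs h => hc (h.1 hs))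

theorem strip_case (L : ℕ) [NeZero L] (A : Set (Site L)) (d : Fin 3)
    (h : ∀ l, ∃ c, Bri L A d l c) : 2 * L ∣ A.ncard := by
  choose c hc using h
  obtain ⟨d', hd⟩ : ∃ d' : Fin 3, d ≠ d' := by
    fin_cases d
    · exact ⟨1, by decide⟩
    · exact ⟨2, by decide⟩
    · exact ⟨0, by decide⟩
  have hb := lab_bij L d d' hd
  have e : A = (fun s : Site L => ((lab L d s, lab L d' s), s.2)) ⁻¹'
      (({l | c l} ×ˢ (Set.univ : Set (ZMod L))) ×ˢ (Set.univ : Set Bool)) := by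
    ext s
    simp [hc _ s rfl]
  have h1 : A.ncard = (({l | c l} ×ˢ (Set.univ : Set (ZMod L))) ×ˢ (Set.univ : Set Bool)).ncard := by
    rw [e]
    exact Set.ncard_preimage_of_injective_subset_range hb.1 (by rw [hb.2.range_eq]; exact Set.subset_univ _)
  rw [h1, Set.ncard_prod, Set.ncard_prod, Set.ncard_univ, Set.ncard_univ]
  simp
  exact ⟨({l | c l} : Set (ZMod L)).ncard, by ring⟩

theorem iso (L : ℕ) [NeZero L] (hL : 2 ≤ L) (A : Set (Site L)) (he : Even A.ncard)
    (hd : ¬ 2 * L ∣ A.ncard) (h1 : 8 * L ^ 2 < 9 * A.ncard) (h2 : 9 * A.ncard < 10 * L ^ 2) :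
    2 * L + 2 ≤ per L A := by
  have hpar := per_parity L hL A
  rw [ZMod.natCast_eq_natCast_iff'] at hpar
  by_contra hlt
  have hper : per L A ≤ 2 * L := by
    obtain ⟨r, hr⟩ := he
    omega
  have hcompl : A.ncard + Aᶜ.ncard = 2 * L ^ 2 := by
    rw [Set.ncard_add_ncard_compl]
    simp [Nat.card_eq_fintype_card, ZMod.card]
    ring
  have nocross : ∀ d d' : Fin 3, d ≠ d' → ∀ l l', ¬ ((∃ c, Bri L A d l c) ∧ ∃ c, Bri L A d' l' c) := by
    rintro d d' hdd l l' ⟨⟨c, hc⟩, c', hc'⟩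
    rcases cross_case L hL A hper d d' hdd l l' c c' hc hc' with h | h <;> omega
  have hsum := (nonBri_sum L hL A).trans hper
  have full : ∀ d, (∀ l, ¬ ∃ c, Bri L A d l c) → (nonBri L A d).ncard = L := by
    intro d h
    have : nonBri L A d = Set.univ := by ext l; simpa [nonBri] using h l
    rw [this, Set.ncard_univ]
    simp
  have nofull : ∀ d, (nonBri L A d).ncard ≠ 0 := by
    intro d h
    rw [Set.ncard_eq_zero (Set.toFinite _)] at h
    refine hd (strip_case L A d fun l => ?_)
    by_contra h'
    have : l ∈ nonBri L A d := h'
    rw [h] at this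
    exact this
  have alt : ∀ d d' : Fin 3, d ≠ d' → (nonBri L A d).ncard = L ∨ (nonBri L A d').ncard = L := by
    intro d d' hdd
    by_cases h : ∃ l, ∃ c, Bri L A d l c
    · right
      obtain ⟨l, hl⟩ := h
      exact full d' fun l' h' => nocross d d' hdd l l' ⟨hl, h'⟩
    · left
      push Not at h
      exact full d fun l ⟨c, hc⟩ => h l c hc
  have a1 := alt 0 1 (by decide)
  have a2 := alt 0 2 (by decide)
  have a3 := alt 1 2 (by decide)
  have b0 := nofull 0
  have b1 := nofull 1
  have b2 := nofull 2
  omega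

theorem exists_k (L : ℕ) (hL : 8 ≤ L) : ∃ k : ℕ, Even k ∧ ¬ 2 * L ∣ k ∧ 8 * L ^ 2 < 9 * k ∧
    9 * k < 10 * L ^ 2 ∧ k ≤ 2 * L ^ 2 := by
  rcases Nat.even_or_odd' L with ⟨m, hm | hm⟩
  · refine ⟨L ^ 2 + 2, ?_, ?_, by omega, by nlinarith, by nlinarith⟩
    · rw [hm]; exact ⟨2 * m ^ 2 + 1, by ring⟩
    · intro h
      have h1 : 2 * L ∣ L ^ 2 := ⟨m, by rw [hm]; ring⟩
      have h2 := (Nat.dvd_add_right h1).1 h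
      have := Nat.le_of_dvd (by norm_num) h2
      omega
  · refine ⟨L ^ 2 + 1, ?_, ?_, by nlinarith, by nlinarith, by nlinarith⟩
    · rw [hm]; exact ⟨2 * m ^ 2 + 2 * m + 1, by ring⟩
    · intro h
      have h1 : L ∣ L ^ 2 + 1 := dvd_trans ⟨2, by ring⟩ h
      have h2 := (Nat.dvd_add_right (dvd_pow_self L two_ne_zero)).1 h1
      have := Nat.le_of_dvd (by norm_num) h2
      omega

theorem ivt (f : ℕ → ℕ) (N k : ℕ) (h0 : f 0 ≤ k) (hN : k ≤ f N)
    (hs : ∀ n < N, f (n + 1) ≤ f n + 1) : ∃ n ≤ N, f n = k := by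
  induction N with
  | zero => exact ⟨0, le_rfl, by omega⟩
  | succ N ih =>
    by_cases h : k ≤ f N
    · obtain ⟨n, hn, e⟩ := ih h (fun n hn => hs n (by omega))
      exact ⟨n, by omega, e⟩
    · have := hs N (by omega)
      exact ⟨N + 1, le_rfl, by omega⟩

theorem lower (L q : ℕ) [NeZero L] (hL : 8 ≤ L) (a b : Fin q) (hab : a ≠ b) (t : ℕ)
    (h : ConnBelow L q t (groundConf L q a) (groundConf L q b)) : 2 * L + 2 ≤ t := by
  obtain ⟨N, ω, w0, wN, w1, w2⟩ := h
  obtain ⟨k, k1, k2, k3, k4, k5⟩ := exists_k L hL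
  obtain ⟨n, hn, hk⟩ := ivt (fun n => ({s | ω n s ≠ a} : Set (Site L)).ncard) N k
    (by simp [w0, groundConf])
    (by
      have : ({s | ω N s ≠ a} : Set (Site L)) = Set.univ := by
        ext s; simp [wN, groundConf, hab.symm]
      simp only [this, Set.ncard_univ]
      simp [Nat.card_eq_fintype_card, ZMod.card]
      nlinarith)
    (by
      intro n hn
      obtain ⟨x, -, hx⟩ := w1 n hn
      have : ({s | ω (n + 1) s ≠ a} : Set (Site L)) ⊆ insert x {s | ω n s ≠ a} := by
        intro s hs
        by_cases h : s = x
        · left; exact h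
        · right
          have := hx s h
          simp only [Set.mem_ofPred_eq] at hs ⊢
          rwa [this]
      exact (Set.ncard_le_ncard this (Set.toFinite _)).trans (Set.ncard_insert_le _ _))
  have h1 := iso L (by omega) {s | ω n s ≠ a} (by rw [hk]; exact k1) (by rw [hk]; exact k2)
    (by rw [hk]; exact k3) (by rw [hk]; exact k4)
  exact h1.trans ((per_le_Ham L q a (ω n)).trans (w2 n hn))

/-- Theorem 3.1 (hexagonal lattice): the energy barrier between any two distinct ground
states equals `Γ = 2L + 2`, and there is no valley of depth larger than `Γ`:
`min_{𝐬 ∈ S} Φ(σ, 𝐬) - H(σ) < Γ` for every `σ ∉ S`. -/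
theorem energy_barrier (L q : ℕ) (hL : 8 ≤ L) (hq : 2 ≤ q) :
    (∀ a b : Fin q, a ≠ b →
      commHeight L q (groundConf L q a) (groundConf L q b) = 2 * L + 2) ∧
    (∀ σ : Conf L q, σ ∉ groundSet L q →
      sInf (Set.range fun a : Fin q => commHeight L q σ (groundConf L q a)) <
        Ham L q σ + (2 * L + 2)) := by
  have : NeZero L := ⟨by omega⟩
  refine ⟨fun a b hab => ?_, fun σ hσ => ?_⟩
  · have hmem : 2 * L + 2 ∈ {t : ℕ | ConnBelow L q t (groundConf L q a) (groundConf L q b)} :=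
      upper L q (by omega) a b
    refine le_antisymm (Nat.sInf_le hmem) ?_
    exact lower L q hL a b hab _ (Nat.sInf_mem ⟨_, hmem⟩)
  · have h1 := valley L q (by omega) hq σ hσ ⟨0, by omega⟩
    have h2 : commHeight L q σ (groundConf L q ⟨0, by omega⟩) ≤ Ham L q σ + (2 * L + 1) :=
      Nat.sInf_le h1
    have h3 : sInf (Set.range fun a : Fin q => commHeight L q σ (groundConf L q a)) ≤
        commHeight L q σ (groundConf L q ⟨0, by omega⟩) := Nat.sInf_le ⟨_, rfl⟩
    omega

end IsingHex
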